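/- Let G be a finite group such that the center Z(G) has order 2, the commutator subgroup of G equals Z(G), and g² ∈ Z(G) for every g ∈ G (so G is an extraspecial 2-group). Then any two faithful irreducible complex representations of G on finite-dimensional complex vector spaces are isomorphic (equivalent as representations). -/

import Mathlib

open scoped commutatorElement

namespace Representation

variable {k G V W : Type*} [Field k] [Group G] [AddCommGroup V] [Module k V]
  [AddCommGroup W] [Module k W]

/-- A central involution that acts nontrivially on an irreducible representation acts as `-1`. -/
theorem eq_neg_one_of_mem_center {ρ : Representation k G V}
    (hirr : ∀ U : Submodule k V, (∀ (g : G) (v : V), v ∈ U → ρ g v ∈ U) → U = ⊥ ∨ U = ⊤)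
    {c : G} (hc : c ∈ Subgroup.center G) (hc2 : c ^ 2 = 1) (hne : ρ c ≠ 1) : ρ c = -1 := by
  have hcc (v : V) : ρ c (ρ c v) = v := by
    rw [← Module.End.mul_apply, ← map_mul, ← sq, hc2, map_one, Module.End.one_apply]
  have hker : LinearMap.ker (ρ c - 1) = ⊥ := by
    refine (hirr _ fun g v hv ↦ ?_).resolve_right fun h ↦ ?_
    · simp only [LinearMap.mem_ker, LinearMap.sub_apply, Module.End.one_apply, sub_eq_zero] at hv ⊢
      rw [← Module.End.mul_apply, ← map_mul, ← Subgroup.mem_center_iff.mp hc g, map_mul,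
        Module.End.mul_apply, hv]
    · exact hne (sub_eq_zero.mp (LinearMap.ker_eq_top.mp h))
  ext v
  have hv : ρ c v + v ∈ LinearMap.ker (ρ c - 1) := by
    simp [hcc, add_comm]
  rw [hker, Submodule.mem_bot] at hv
  simpa using eq_neg_of_add_eq_zero_left hv

/-- If every nontrivial central element acts as `-1` and commutators are central, then the
character vanishes outside of the center. -/
theorem character_eq_zero_of_notMem_center [CharZero k] {ρ : Representation k G V}
    (hcomm : commutator G ≤ Subgroup.center G)
    (hneg : ∀ c ∈ Subgroup.center G, c ≠ 1 → ρ c = -1) {g : G} (hg : g ∉ Subgroup.center G) :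
    ρ.character g = 0 := by
  obtain ⟨h, hh⟩ : ∃ h : G, h * g ≠ g * h := by
    simpa [Subgroup.mem_center_iff] using hg
  have hc : ⁅h, g⁆ ∈ Subgroup.center G := hcomm <| by
    rw [commutator_def]
    exact Subgroup.commutator_mem_commutator (Subgroup.mem_top h) (Subgroup.mem_top g)
  have hc1 : ⁅h, g⁆ ≠ 1 := fun h1 ↦ hh (commutatorElement_eq_one_iff_mul_comm.mp h1)
  have key : ρ.character g = -ρ.character g := by
    conv_lhs => rw [← char_conj ρ g h]
    have : h * g * h⁻¹ = ⁅h, g⁆ * g := by simp [commutatorElement_def]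
    rw [this, character, map_mul, hneg _ hc hc1, neg_one_mul, map_neg, character]
  exact self_eq_neg.mp key

theorem exists_intertwiningMap_ne_zero [CharZero k] [Finite G]
    [FiniteDimensional k V] [Nontrivial V] [FiniteDimensional k W] [Nontrivial W]
    {ρ : Representation k G V} {σ : Representation k G W}
    (hcomm : commutator G ≤ Subgroup.center G)
    (hρ : ∀ c ∈ Subgroup.center G, c ≠ 1 → ρ c = -1)
    (hσ : ∀ c ∈ Subgroup.center G, c ≠ 1 → σ c = -1) :
    ∃ f : IntertwiningMap ρ σ, f ≠ 0 := by
  classical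
  have := Fintype.ofFinite G
  have hG : (Nat.card G : k) ≠ 0 := Nat.cast_ne_zero.mpr Nat.card_pos.ne'
  have := invertibleOfNonzero hG
  by_contra! hall
  have : Subsingleton (IntertwiningMap ρ σ) := subsingleton_of_forall_eq 0 hall
  have hsum := card_inv_mul_sum_char_mul_char_eq_finrank ρ σ
  have hterm (g : G) : σ.character g * ρ.character g⁻¹ =
      if g ∈ Subgroup.center G then (Module.finrank k W * Module.finrank k V : k) else 0 := by
    split_ifs with hg
    · rcases eq_or_ne g 1 with rfl | h1
      · simp
      · simp [character, hσ g hg h1, hρ g⁻¹ (inv_mem hg) (inv_ne_one.mpr h1)]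
    · rw [character_eq_zero_of_notMem_center hcomm hσ hg, zero_mul]
  rw [Module.finrank_zero_of_subsingleton, Nat.cast_zero] at hsum
  have hcard : (Finset.univ.filter (· ∈ Subgroup.center G)).card ≠ 0 :=
    Finset.card_ne_zero_of_mem (a := 1) (by simp [one_mem])
  simp only [hterm, ← Finset.sum_filter, Finset.sum_const, nsmul_eq_mul, mul_eq_zero, inv_eq_zero,
    Nat.cast_eq_zero, hcard, Module.finrank_pos.ne', Nat.card_pos.ne', or_self] at hsum

end Representation


/-- Any two faithful irreducible complex representations of an extraspecial
2-group are isomorphic. -/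
theorem extraspecial_two_group_faithful_irreducible_unique
    {G : Type*} [Group G] [Finite G]
    (hZ : Nat.card (Subgroup.center G) = 2)
    (hcomm : commutator G = Subgroup.center G)
    (hsq : ∀ g : G, g ^ 2 ∈ Subgroup.center G)
    (V1 : Type*) [AddCommGroup V1] [Module ℂ V1] [FiniteDimensional ℂ V1] [Nontrivial V1]
    (V2 : Type*) [AddCommGroup V2] [Module ℂ V2] [FiniteDimensional ℂ V2] [Nontrivial V2]
    (ρ1 : Representation ℂ G V1) (ρ2 : Representation ℂ G V2)
    (hfaithful1 : Function.Injective ρ1) (hfaithful2 : Function.Injective ρ2)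
    (hirr1 : ∀ W : Submodule ℂ V1, (∀ (g : G) (v : V1), v ∈ W → ρ1 g v ∈ W) → W = ⊥ ∨ W = ⊤)
    (hirr2 : ∀ W : Submodule ℂ V2, (∀ (g : G) (v : V2), v ∈ W → ρ2 g v ∈ W) → W = ⊥ ∨ W = ⊤) :
    ∃ T : V1 ≃ₗ[ℂ] V2, ∀ (g : G) (v : V1), T (ρ1 g v) = ρ2 g (T v) := by
  have hc2 (c : G) (hc : c ∈ Subgroup.center G) : c ^ 2 = 1 := by
    rw [← hZ]
    exact congrArg Subtype.val (pow_card_eq_one' (x := (⟨c, hc⟩ : Subgroup.center G)))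
  obtain ⟨f, hf⟩ := Representation.exists_intertwiningMap_ne_zero (ρ := ρ1) (σ := ρ2) hcomm.le
    (fun c hc h1 ↦ Representation.eq_neg_one_of_mem_center hirr1 hc (hc2 c hc)
      ((map_ne_one_iff ρ1 hfaithful1).mpr h1))
    (fun c hc h1 ↦ Representation.eq_neg_one_of_mem_center hirr2 hc (hc2 c hc)
      ((map_ne_one_iff ρ2 hfaithful2).mpr h1))
  have hf0 : f.toLinearMap ≠ 0 := fun h ↦ hf (Representation.IntertwiningMap.ext h)
  have hker : LinearMap.ker f.toLinearMap = ⊥ :=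
    (hirr1 _ f.ker.apply_mem_toSubmodule).resolve_right fun h ↦ hf0 (LinearMap.ker_eq_top.mp h)
  have hrange : LinearMap.range f.toLinearMap = ⊤ :=
    (hirr2 _ f.range.apply_mem_toSubmodule).resolve_left fun h ↦ hf0 (LinearMap.range_eq_bot.mp h)
  exact ⟨LinearEquiv.ofBijective f.toLinearMap
    ⟨LinearMap.ker_eq_bot.mp hker, LinearMap.range_eq_top.mp hrange⟩, f.isIntertwining⟩
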